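/- Fix 3 ≤ p ≤ n − 1 and q ∈ {p+1,…,n}, and assume λ_1 > … > λ_n > 0. Then the Jacobian of the arbitrary-eigenpair system at the equilibrium (v_q, λ_q), conjugated by T = [[V,0],[0ᵀ,1]], is diagonal with entries: −1 at positions 1,…,p−1, λ_q⁻¹λ_p − 1 at position p, λ_q⁻¹λ_k − 1 at positions k = p+1,…,n with k ≠ q, −1 at position q, and −1 at position n+1. In particular the entry λ_q⁻¹λ_p − 1 is strictly positive, so every equilibrium (v_q, λ_q) with q > p is a saddle point. -/

import Mathlib

open Matrix

/-- The right-hand side of the coupled learning rule for the `p`-th eigenpair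
(`0`-based index `p`). -/
noncomputable def arbSys {n : ℕ} (C : Matrix (Fin n) (Fin n) ℝ)
    (v : Fin n → (Fin n → ℝ)) (lam : Fin n → ℝ) (p : Fin n)
    (x : (Fin n → ℝ) × ℝ) : (Fin n → ℝ) × ℝ :=
  (x.2⁻¹ • (C *ᵥ x.1 - (x.1 ⬝ᵥ C *ᵥ x.1) • x.1) + ((x.1 ⬝ᵥ x.1 - 1) / 2) • x.1
      - (∑ i ∈ Finset.univ.filter (fun i : Fin n => i < p),
          ((lam i - x.2)⁻¹ + x.2⁻¹) • Matrix.vecMulVec (v i) (v i)) *ᵥ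
        (C *ᵥ x.1 - x.2 • x.1),
   x.1 ⬝ᵥ C *ᵥ x.1 - x.2 * (x.1 ⬝ᵥ x.1))

/-- The `(n+1) × (n+1)` matrix of a continuous linear map on `ℝⁿ × ℝ` with
respect to the standard basis. -/
noncomputable def clmMatrix {n : ℕ}
    (L : ((Fin n → ℝ) × ℝ) →L[ℝ] ((Fin n → ℝ) × ℝ)) :
    Matrix (Fin n ⊕ Unit) (Fin n ⊕ Unit) ℝ :=
  Matrix.of fun i j =>
    Sum.elim
      (fun i' => (L (Sum.elim (fun j' => (Pi.single j' (1 : ℝ), (0 : ℝ)))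
        (fun _ => (0, 1)) j)).1 i')
      (fun _ => (L (Sum.elim (fun j' => (Pi.single j' (1 : ℝ), (0 : ℝ)))
        (fun _ => (0, 1)) j)).2) i

/-- `clmMatrix L` represents `L` in the standard basis. -/
theorem clmMatrix_mulVec {n : ℕ} (L : ((Fin n → ℝ) × ℝ) →L[ℝ] ((Fin n → ℝ) × ℝ))
    (x : Fin n ⊕ Unit → ℝ) :
    clmMatrix L *ᵥ x =
      Sum.elim (L (fun i => x (Sum.inl i), x (Sum.inr ()))).1
        (fun _ => (L (fun i => x (Sum.inl i), x (Sum.inr ()))).2) := by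
  have hx : ((fun i => x (Sum.inl i), x (Sum.inr ())) : (Fin n → ℝ) × ℝ) =
      ∑ i, x (Sum.inl i) • ((Pi.single i (1 : ℝ), (0 : ℝ)) : (Fin n → ℝ) × ℝ) +
        x (Sum.inr ()) • ((0, 1) : (Fin n → ℝ) × ℝ) := by
    ext j
    · simp [Prod.fst_sum, Finset.sum_apply, Pi.single_apply]
    · simp [Prod.snd_sum]
  rw [hx, map_add, map_sum]
  simp only [map_smul]
  ext (i | i)
  · simp [clmMatrix, Matrix.mulVec, dotProduct, Prod.fst_sum, Finset.sum_apply, mul_comm]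
  · simp [clmMatrix, Matrix.mulVec, dotProduct, Prod.snd_sum, mul_comm]

/-- Conjugation by an orthonormal eigenbasis diagonalizes `clmMatrix L`. -/
theorem conj_clmMatrix_eq_diagonal {n : ℕ} {v : Fin n → (Fin n → ℝ)}
    (horth : ∀ i j, v i ⬝ᵥ v j = if i = j then (1 : ℝ) else 0)
    {L : ((Fin n → ℝ) × ℝ) →L[ℝ] ((Fin n → ℝ) × ℝ)} {d : Fin n → ℝ} {e : ℝ}
    (hL : ∀ k, L (v k, 0) = (d k • v k, 0)) (hL' : L (0, 1) = (0, e)) :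
    (Matrix.fromBlocks (Matrix.of fun i j => v j i)
        (0 : Matrix (Fin n) Unit ℝ) (0 : Matrix Unit (Fin n) ℝ)
        (1 : Matrix Unit Unit ℝ))ᵀ * clmMatrix L *
      (Matrix.fromBlocks (Matrix.of fun i j => v j i)
        (0 : Matrix (Fin n) Unit ℝ) (0 : Matrix Unit (Fin n) ℝ)
        (1 : Matrix Unit Unit ℝ)) = Matrix.diagonal (Sum.elim d fun _ => e) := by
  set T : Matrix (Fin n ⊕ Unit) (Fin n ⊕ Unit) ℝ :=
    Matrix.fromBlocks (Matrix.of fun i j => v j i) 0 0 1 with hT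
  have hTT : Tᵀ * T = 1 := by
    have hV : (Matrix.of fun i j => v j i)ᵀ * (Matrix.of fun i j => v j i) =
        (1 : Matrix (Fin n) (Fin n) ℝ) := by
      ext i j
      simpa [Matrix.mul_apply, dotProduct, Matrix.one_apply] using horth i j
    rw [hT, Matrix.fromBlocks_transpose, Matrix.fromBlocks_multiply]
    simp [hV]
  have hMT : clmMatrix L * T = T * Matrix.diagonal (Sum.elim d fun _ => e) := by
    ext i j
    have h : (clmMatrix L * T) i j = (clmMatrix L *ᵥ fun k => T k j) i := rfl
    rw [h, clmMatrix_mulVec, Matrix.mul_diagonal]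
    rcases j with j | j
    · have h1 : L (fun i => T (Sum.inl i) (Sum.inl j), T (Sum.inr ()) (Sum.inl j)) =
          (d j • v j, 0) := hL j
      rw [h1]
      rcases i with i | i <;> simp [hT, mul_comm]
    · have h1 : L (fun i => T (Sum.inl i) (Sum.inr j), T (Sum.inr ()) (Sum.inr j)) =
          (0, e) := hL'
      rw [h1]
      rcases i with i | i <;> simp [hT]
  rw [Matrix.mul_assoc, hMT, ← Matrix.mul_assoc, hTT, Matrix.one_mul]

theorem HasFDerivAt.dotProduct {E ι : Type*} [NormedAddCommGroup E] [NormedSpace ℝ E] [Fintype ι]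
    {f g : E → ι → ℝ} {f' g' : E →L[ℝ] ι → ℝ} {x : E}
    (hf : HasFDerivAt f f' x) (hg : HasFDerivAt g g' x) :
    HasFDerivAt (fun y => f y ⬝ᵥ g y)
      (∑ i, (f x i • (ContinuousLinearMap.proj i).comp g' +
        g x i • (ContinuousLinearMap.proj i).comp f')) x :=
  HasFDerivAt.fun_sum fun i _ => ((hasFDerivAt_pi'.1 hf) i).mul ((hasFDerivAt_pi'.1 hg) i)

/-- The Fréchet derivative of `arbSys` at a unit eigenvector whose eigenvalue is nonzero and not
deflated. -/
theorem exists_hasFDerivAt_arbSys {n : ℕ} {C : Matrix (Fin n) (Fin n) ℝ} (hC : C.IsSymm)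
    (v : Fin n → (Fin n → ℝ)) (lam : Fin n → ℝ) (p : Fin n) {w : Fin n → ℝ} {l : ℝ}
    (hw : w ⬝ᵥ w = 1) (hCw : C *ᵥ w = l • w) (hl : l ≠ 0) (hlam : ∀ i < p, lam i ≠ l) :
    ∃ L : ((Fin n → ℝ) × ℝ) →L[ℝ] ((Fin n → ℝ) × ℝ),
      HasFDerivAt (arbSys C v lam p) L (w, l) ∧
      ∀ u m, L (u, m) =
        (l⁻¹ • (C *ᵥ u - l • u) - (w ⬝ᵥ u) • w -
          ∑ i ∈ Finset.univ.filter (fun i : Fin n => i < p),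
            ((lam i - l)⁻¹ + l⁻¹) • (v i ⬝ᵥ (C *ᵥ u - l • u - m • w)) • v i, -m) := by
  have hsymm (u : Fin n → ℝ) : w ⬝ᵥ C *ᵥ u = l * (w ⬝ᵥ u) := by
    rw [Matrix.dotProduct_mulVec, ← Matrix.mulVec_transpose, hC.eq, hCw, smul_dotProduct,
      smul_eq_mul]
  have h1 : HasFDerivAt (fun x : (Fin n → ℝ) × ℝ => x.1)
    (ContinuousLinearMap.fst ℝ (Fin n → ℝ) ℝ) (w, l) := hasFDerivAt_fst
  have h2 : HasFDerivAt (fun x : (Fin n → ℝ) × ℝ => x.2)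
    (ContinuousLinearMap.snd ℝ (Fin n → ℝ) ℝ) (w, l) := hasFDerivAt_snd
  have hM : HasFDerivAt (fun x : (Fin n → ℝ) × ℝ => C *ᵥ x.1)
      ((LinearMap.toContinuousLinearMap (Matrix.mulVecLin C)).comp
        (ContinuousLinearMap.fst ℝ (Fin n → ℝ) ℝ)) (w, l) :=
    (LinearMap.toContinuousLinearMap (Matrix.mulVecLin C)).hasFDerivAt.comp (w, l) h1
  have hinv : HasFDerivAt (fun x : (Fin n → ℝ) × ℝ => x.2⁻¹) _ (w, l) :=
    (hasDerivAt_inv hl).comp_hasFDerivAt (w, l) h2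
  have hq := h1.dotProduct hM
  have hn := h1.dotProduct h1
  have hsum : HasFDerivAt (fun x : (Fin n → ℝ) × ℝ =>
      ∑ i ∈ Finset.univ.filter (fun i : Fin n => i < p),
        ((lam i - x.2)⁻¹ + x.2⁻¹) • (v i ⬝ᵥ (C *ᵥ x.1 - x.2 • x.1)) • v i) _ (w, l) :=
    HasFDerivAt.fun_sum fun i hi =>
      (((hasDerivAt_inv (sub_ne_zero.2 (hlam i (Finset.mem_filter.1 hi).2))).comp_hasFDerivAt
        (w, l) (h2.const_sub (lam i))).add hinv).fun_smul
        (((hasFDerivAt_const (v i) (w, l)).dotProduct (hM.fun_sub (h2.fun_smul h1))).smul_const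
          (v i))
  have key := (((hinv.fun_smul (hM.fun_sub (hq.fun_smul h1))).fun_add
    (((hn.sub_const 1).mul_const 2⁻¹).fun_smul h1)).fun_sub hsum).prodMk
      (hq.fun_sub (h2.fun_mul hn))
  refine ⟨_, key.congr_of_eventuallyEq (.of_forall fun x => ?_), fun u m => ?_⟩
  · simp only [arbSys, Matrix.sum_mulVec, Matrix.smul_mulVec, Matrix.vecMulVec_mulVec,
      div_eq_mul_inv, op_smul_eq_smul]
  · have hd (a b : Fin n → ℝ) : ∑ i, a i * b i = a ⬝ᵥ b := rfl
    have hlw : (fun i => l * w i) ⬝ᵥ u = l * (w ⬝ᵥ u) := smul_dotProduct l w u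
    have hres : (fun i => (C *ᵥ u) i - (l * u i + m * w i)) = C *ᵥ u - l • u - m • w :=
      funext fun i => (sub_sub _ _ _).symm
    refine Prod.ext ?_ ?_
    · simp [hCw, hw, hd, hsymm, Finset.sum_add_distrib, hlw, hres]
      ext i
      simp only [Pi.smul_apply, Pi.sub_apply, Pi.add_apply, smul_eq_mul]
      field_simp
      ring
    · simp [hCw, hw, hd, hsymm, Finset.sum_add_distrib, hlw]

/-- For `q > p`, the Jacobian of the arbitrary-eigenpair
system at `(v_q, λ_q)`, conjugated by `T = [[V, 0], [0ᵀ, 1]]`, is diagonal with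
entries `−1` at positions `k < p`, `λ_q⁻¹ λ_p − 1` at position `p`,
`λ_q⁻¹ λ_k − 1` at positions `k > p` with `k ≠ q`, `−1` at position `q` and at
the last position; the entry `λ_q⁻¹ λ_p − 1` is strictly positive, so every
equilibrium `(v_q, λ_q)` with `q > p` is a saddle point. -/
theorem arbitrary_eigenpair_saddle_following
    (n : ℕ) (hn : 4 ≤ n)
    (C : Matrix (Fin n) (Fin n) ℝ) (hC : C.IsSymm)
    (v : Fin n → (Fin n → ℝ)) (lam : Fin n → ℝ)
    (horth : ∀ i j, v i ⬝ᵥ v j = if i = j then (1 : ℝ) else 0)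
    (heig : ∀ k, C *ᵥ v k = lam k • v k)
    (hdec : StrictAnti lam) (hpos : ∀ k, 0 < lam k)
    (p : Fin n) (hp2 : 2 ≤ (p : ℕ)) (hpn : (p : ℕ) ≤ n - 2)
    (q : Fin n) (hq : p < q) :
    ∃ L : ((Fin n → ℝ) × ℝ) →L[ℝ] ((Fin n → ℝ) × ℝ),
      HasFDerivAt (arbSys C v lam p) L (v q, lam q) ∧
      (Matrix.fromBlocks (Matrix.of fun i j => v j i)
          (0 : Matrix (Fin n) Unit ℝ) (0 : Matrix Unit (Fin n) ℝ)
          (1 : Matrix Unit Unit ℝ))ᵀ * clmMatrix L *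
        (Matrix.fromBlocks (Matrix.of fun i j => v j i)
          (0 : Matrix (Fin n) Unit ℝ) (0 : Matrix Unit (Fin n) ℝ)
          (1 : Matrix Unit Unit ℝ))
        = Matrix.diagonal
            (Sum.elim
              (fun k : Fin n =>
                if k < p then (-1 : ℝ)
                else if k = p then (lam q)⁻¹ * lam p - 1
                else if k = q then (-1 : ℝ)
                else (lam q)⁻¹ * lam k - 1)
              (fun _ => (-1 : ℝ))) ∧
      0 < (lam q)⁻¹ * lam p - 1 := by
  have hlq : lam q ≠ 0 := (hpos q).ne'
  have hlt : ∀ i < p, lam i ≠ lam q := fun i hi => (hdec (hi.trans hq)).ne'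
  obtain ⟨L, hL, hLapp⟩ :=
    exists_hasFDerivAt_arbSys hC v lam p (by simpa using horth q q) (heig q) hlq hlt
  refine ⟨L, hL, conj_clmMatrix_eq_diagonal horth (fun k => ?_) ?_, ?_⟩
  · have hres : C *ᵥ v k - lam q • v k - (0 : ℝ) • v q = (lam k - lam q) • v k := by
      rw [heig, zero_smul, sub_zero, sub_smul]
    rw [hLapp, hres, heig, ← sub_smul]
    simp only [dotProduct_smul, horth, smul_eq_mul, mul_ite, mul_one, mul_zero, ite_smul,
      zero_smul, smul_ite, smul_zero, Finset.sum_ite_eq', Finset.mem_filter, Finset.mem_univ,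
      true_and, neg_zero]
    rcases eq_or_ne q k with rfl | hqk
    · simp [hq.not_gt, hq.ne']
    · rw [if_neg hqk, sub_zero, if_neg hqk.symm]
      ext i
      · split_ifs with hk hkp
        · have h0 : lam k - lam q ≠ 0 := sub_ne_zero.2 (hlt k hk)
          simp only [Pi.smul_apply, Pi.sub_apply, smul_eq_mul]
          field_simp
          ring
        · subst hkp
          simp only [sub_zero, Pi.smul_apply, smul_eq_mul]
          field_simp
        · simp only [sub_zero, Pi.smul_apply, smul_eq_mul]
          field_simp
      · rfl
  · rw [hLapp]
    simp [horth, hq.not_gt]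
  · rw [sub_pos, inv_mul_eq_div, one_lt_div (hpos q)]
    exact hdec hq
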